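/- Let (A, {Δ(λ)}_{λ∈Λ}) be a split quasi-hereditary algebra over a commutative Noetherian ring R, and (A, P, V) an RQF3 algebra. Then for every λ ∈ Λ, domdim_{(A,R)} Δ(λ) ≥ domdim(A, R) − d(Λ, λ), where d(Λ, λ) is the length of the longest chain in Λ starting at λ. -/

import Mathlib

open Function

section Basics

/-- A predicate on left `A`-modules, describing a full subcategory of `A`-mod. -/
def ModPred (A : Type) [Ring A] : Type 1 :=
  (M : Type) → [AddCommGroup M] → [Module A M] → Prop

/-- `T` is a direct summand of `W` (as `A`-modules). -/
def IsSummandOf (A : Type) [Ring A] (T W : Type) [AddCommGroup T] [Module A T]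
    [AddCommGroup W] [Module A W] : Prop :=
  ∃ (i : T →ₗ[A] W) (r : W →ₗ[A] T), r.comp i = LinearMap.id

/-- `M` has a finite filtration whose subquotients lie in `Θ`. -/
inductive HasFilt (A : Type) [Ring A] (Θ : ModPred A) :
    (M : Type) → [AddCommGroup M] → [Module A M] → Prop
  | of_subsingleton (M : Type) [AddCommGroup M] [Module A M] :
      Subsingleton M → HasFilt A Θ M
  | step (K M Q : Type) [AddCommGroup K] [Module A K] [AddCommGroup M] [Module A M]
      [AddCommGroup Q] [Module A Q] (i : K →ₗ[A] M) (p : M →ₗ[A] Q)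
      (hi : Function.Injective i) (hp : Function.Surjective p)
      (hex : Function.Exact i p) (hQ : Θ Q) (hK : HasFilt A Θ K) : HasFilt A Θ M

end Basics

section RelativeInjectives

variable (R : Type) [CommRing R] (A : Type) [Ring A] [Algebra R A]

/-- The dual `D A = Hom_R(A, R)` is a left `A`-module via `(a • f) x = f (x * a)`. -/
noncomputable instance dualModule : Module A (A →ₗ[R] R) where
  smul a f := f.comp (LinearMap.mulRight R a)
  one_smul f := LinearMap.ext fun x => by
    show f ((LinearMap.mulRight R (1 : A)) x) = f x
    rw [LinearMap.mulRight_apply, mul_one]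
  mul_smul a b f := LinearMap.ext fun x => by
    show f ((LinearMap.mulRight R (a * b)) x)
      = f ((LinearMap.mulRight R b) ((LinearMap.mulRight R a) x))
    simp only [LinearMap.mulRight_apply, mul_assoc]
  smul_zero a := rfl
  smul_add a f g := rfl
  add_smul a b f := LinearMap.ext fun x => by
    show f ((LinearMap.mulRight R (a + b)) x)
      = f ((LinearMap.mulRight R a) x) + f ((LinearMap.mulRight R b) x)
    simp only [LinearMap.mulRight_apply, mul_add, map_add]
  zero_smul f := LinearMap.ext fun x => by
    show f ((LinearMap.mulRight R (0 : A)) x) = 0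
    simp only [LinearMap.mulRight_apply, mul_zero, map_zero]

/-- `M` is `(A, R)`-injective: it is a direct summand of a finite direct sum of copies of
`D A = Hom_R(A, R)`. -/
noncomputable def IsRelInjective (M : Type) [AddCommGroup M] [Module A M] : Prop :=
  ∃ n : ℕ, IsSummandOf A M (Fin n → (A →ₗ[R] R))

/-- A map is `R`-split (von Neumann regular over `R`): it admits an `R`-linear
quasi-inverse.  An exact sequence of `A`-modules is `(A, R)`-exact precisely when all its
maps have this property. -/
def IsRSplit {X Y : Type} [AddCommGroup X] [AddCommGroup Y] [Module R X] [Module R Y]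
    (f : X → Y) : Prop :=
  ∃ h : Y →ₗ[R] X, ∀ x, f (h (f x)) = f x

/-- A witness that `domdim_{(A,R)} M ≥ t`:  an `(A, R)`-exact sequence
`0 → M → I_1 → ⋯ → I_t` (`I_i = X (i-1)`) with all `I_i` projective and
`(A, R)`-injective. -/
structure RelCoresolution (t : ℕ) (M : Type) [AddCommGroup M] [Module A M]
    [Module R M] [IsScalarTower R A M] : Type 1 where
  X : ℕ → Type
  [grp : ∀ i, AddCommGroup (X i)]
  [modA : ∀ i, Module A (X i)]
  [modR : ∀ i, Module R (X i)]
  [tower : ∀ i, IsScalarTower R A (X i)]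
  projinj : ∀ i, i + 1 ≤ t →
    Module.Finite A (X i) ∧ Module.Projective A (X i) ∧ IsRelInjective R A (X i)
  f : M →ₗ[A] X 0
  d : ∀ i, X i →ₗ[A] X (i + 1)
  hf : 1 ≤ t → Function.Injective f
  hfsplit : 1 ≤ t → IsRSplit R ⇑f
  hexact0 : 2 ≤ t → Function.Exact f (d 0)
  hexact : ∀ i, i + 3 ≤ t → Function.Exact (d i) (d (i + 1))
  hdsplit : ∀ i, i + 2 ≤ t → IsRSplit R ⇑(d i)

attribute [instance] RelCoresolution.grp RelCoresolution.modA RelCoresolution.modR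
  RelCoresolution.tower

/-- The relative dominant dimension of `M` over `(A, R)` is at least `t`. -/
def RelDomDimGE (t : ℕ) (M : Type) [AddCommGroup M] [Module A M]
    [Module R M] [IsScalarTower R A M] : Prop :=
  Nonempty (RelCoresolution R A t M)

/-- `P` is `(A, R)`-strongly faithful: there is an `(A, R)`-monomorphism `A ↪ P^t`. -/
def IsRelStronglyFaithful (P : Type) [AddCommGroup P] [Module A P] [Module R P]
    [IsScalarTower R A P] : Prop :=
  ∃ (t : ℕ) (i : A →ₗ[A] (Fin t → P)), Function.Injective i ∧ IsRSplit R ⇑i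

end RelativeInjectives

section QuasiHereditary

/-- A split quasi-hereditary structure on the `R`-algebra `A`, with weight poset `Λ` and
standard modules `Δ λ`:
(i) the `Δ(λ)` are (finitely generated) projective over `R`;
(ii) `Hom_A(Δ(λ), Δ(μ)) ≠ 0` implies `λ ≤ μ`;
(iii) `End_A(Δ(λ)) ≅ R`;
(iv) each `Δ(λ)` is covered by a finitely generated projective `P(λ)` whose kernel is
filtered by modules `Δ(μ) ⊗ U` (`U ∈ R`-proj, `μ > λ`), realised here as direct summands
of finite direct sums of copies of `Δ(μ)`, `μ > λ`;
(v) `⨁ P(λ)` is a progenerator. -/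
structure SplitQH (R : Type) [CommRing R] (A : Type) [Ring A] [Algebra R A] : Type 1 where
  Λ : Type
  [po : PartialOrder Λ]
  [fintypeΛ : Fintype Λ]
  Δ : Λ → Type
  [grp : ∀ l, AddCommGroup (Δ l)]
  [mod : ∀ l, Module A (Δ l)]
  [modR : ∀ l, Module R (Δ l)]
  [tower : ∀ l, IsScalarTower R A (Δ l)]
  [scc : ∀ l, SMulCommClass A R (Δ l)]
  fin : ∀ l, Module.Finite A (Δ l)
  rproj : ∀ l, Module.Finite R (Δ l) ∧ Module.Projective R (Δ l)
  hom_le : ∀ l m, (∃ φ : Δ l →ₗ[A] Δ m, φ ≠ 0) → l ≤ m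
  endo : ∀ (l : Λ) (φ : Δ l →ₗ[A] Δ l), ∃ c : R, φ = c • (LinearMap.id : Δ l →ₗ[A] Δ l)
  Pr : Λ → Type
  [pgrp : ∀ l, AddCommGroup (Pr l)]
  [pmod : ∀ l, Module A (Pr l)]
  pfin : ∀ l, Module.Finite A (Pr l)
  pproj : ∀ l, Module.Projective A (Pr l)
  π : ∀ l, Pr l →ₗ[A] Δ l
  hπ : ∀ l, Function.Surjective (π l)
  kernel_filtered : ∀ l, ∃ (C : ModuleCat A) (ι : C →ₗ[A] Pr l),
    Function.Injective ι ∧ Function.Exact ι (π l) ∧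
      HasFilt A (fun T [AddCommGroup T] [Module A T] =>
        ∃ m, l < m ∧ ∃ n : ℕ, IsSummandOf A T (Fin n → Δ m)) C
  progen : ∃ n : ℕ, IsSummandOf A A (Fin n → ∀ l, Pr l)

attribute [instance] SplitQH.po SplitQH.fintypeΛ SplitQH.grp SplitQH.mod SplitQH.modR
  SplitQH.tower SplitQH.scc SplitQH.pgrp SplitQH.pmod

end QuasiHereditary

/-- A linear map vanishing on the kernel of a surjection factors through it. -/
theorem exists_factor_of_ker_le {A X Y Z : Type} [Ring A] [AddCommGroup X] [Module A X]
    [AddCommGroup Y] [Module A Y] [AddCommGroup Z] [Module A Z] {q : X →ₗ[A] Y}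
    (hq : Surjective q) (g : X →ₗ[A] Z) (h : LinearMap.ker q ≤ LinearMap.ker g) :
    ∃ a : Y →ₗ[A] Z, ∀ x, a (q x) = g x := by
  refine ⟨((LinearMap.ker q).liftQ g h).comp
    (q.quotKerEquivOfSurjective hq).symm.toLinearMap, fun x => ?_⟩
  have : (q.quotKerEquivOfSurjective hq).symm (q x) = (LinearMap.ker q).mkQ x := by
    rw [LinearEquiv.symm_apply_eq]; rfl
  simp only [LinearMap.comp_apply, LinearEquiv.coe_coe, this]
  rfl

section RelativeInjectives

variable {R : Type} [CommRing R] {A : Type} [Ring A] [Algebra R A]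

/-- A map into `(D A)^n` extends along any `R`-split monomorphism. -/
theorem exists_extend_dual_pi {K E : Type} [AddCommGroup K] [Module A K] [Module R K]
    [IsScalarTower R A K] [AddCommGroup E] [Module A E] [Module R E] [IsScalarTower R A E]
    (i : K →ₗ[A] E) (ρ : E →ₗ[R] K) (hρ : ∀ k, ρ (i k) = k) (n : ℕ)
    (g : K →ₗ[A] (Fin n → (A →ₗ[R] R))) :
    ∃ φ : E →ₗ[A] (Fin n → (A →ₗ[R] R)), ∀ k, φ (i k) = g k := by
  have smul_eval : ∀ (a b : A) (F : A →ₗ[R] R), (a • F) b = F (b * a) := fun _ _ _ => rfl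
  have g_smul : ∀ (r : R) (k : K) (j : Fin n), g (r • k) j 1 = r * g k j 1 := by
    intro r k j
    rw [← algebraMap_smul A r k, map_smul, Pi.smul_apply, smul_eval, one_mul,
      Algebra.algebraMap_eq_smul_one, map_smul, smul_eq_mul]
  refine ⟨{ toFun := fun e j =>
              { toFun := fun a => g (ρ (a • e)) j 1
                map_add' := fun a b => by simp [add_smul]
                map_smul' := fun r a => by simp [g_smul] }
            map_add' := fun x y => by ext; simp
            map_smul' := fun b x => by
              ext j a
              simp [smul_eval, mul_smul] }, fun k => ?_⟩
  ext j a
  simp only [LinearMap.coe_mk, AddHom.coe_mk]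
  rw [← map_smul, hρ, map_smul, Pi.smul_apply, smul_eval, one_mul]

theorem IsRelInjective.exists_extend {I K E : Type} [AddCommGroup I] [Module A I]
    [AddCommGroup K] [Module A K] [Module R K]
    [IsScalarTower R A K] [AddCommGroup E] [Module A E] [Module R E] [IsScalarTower R A E]
    (hI : IsRelInjective R A I)
    (i : K →ₗ[A] E) (ρ : E →ₗ[R] K) (hρ : ∀ k, ρ (i k) = k) (g : K →ₗ[A] I) :
    ∃ φ : E →ₗ[A] I, ∀ k, φ (i k) = g k := by
  obtain ⟨n, u, r, hru⟩ := hI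
  obtain ⟨φ, hφ⟩ := exists_extend_dual_pi i ρ hρ n (u.comp g)
  exact ⟨r.comp φ, fun k => by simpa [hφ] using LinearMap.congr_fun hru (g k)⟩

theorem IsRelInjective.prod {I J : Type} [AddCommGroup I] [Module A I] [AddCommGroup J]
    [Module A J] (hI : IsRelInjective R A I) (hJ : IsRelInjective R A J) :
    IsRelInjective R A (I × J) := by
  obtain ⟨m, u, r, hru⟩ := hI
  obtain ⟨n, v, s, hsv⟩ := hJ
  let e : (Fin (m + n) → (A →ₗ[R] R)) ≃ₗ[A] (Fin m → (A →ₗ[R] R)) × (Fin n → (A →ₗ[R] R)) :=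
    (LinearEquiv.funCongrLeft A (A →ₗ[R] R) finSumFinEquiv).trans
      (LinearEquiv.sumArrowLequivProdArrow _ _ A (A →ₗ[R] R))
  refine ⟨m + n, e.symm.toLinearMap.comp (u.prodMap v), (r.prodMap s).comp e.toLinearMap, ?_⟩
  refine LinearMap.ext fun x => ?_
  have h1 := LinearMap.congr_fun hru x.1
  have h2 := LinearMap.congr_fun hsv x.2
  simp only [LinearMap.comp_apply, LinearMap.id_apply] at h1 h2
  simp [h1, h2]

theorem IsRelInjective.of_subsingleton (I : Type) [AddCommGroup I] [Module A I]
    [Subsingleton I] : IsRelInjective R A I :=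
  ⟨0, 0, 0, LinearMap.ext fun _ => Subsingleton.elim _ _⟩

/-- An injection whose cokernel is `R`-projective has an `R`-linear retraction. -/
theorem exists_retraction_of_projective {K E C : Type} [AddCommGroup K] [Module A K] [Module R K]
    [IsScalarTower R A K] [AddCommGroup E] [Module A E] [Module R E] [IsScalarTower R A E]
    [AddCommGroup C] [Module A C] [Module R C] [IsScalarTower R A C]
    [Module.Projective R C] {i : K →ₗ[A] E} {p : E →ₗ[A] C} (hi : Injective i)
    (hp : Surjective p) (hex : Exact i p) : ∃ ρ : E →ₗ[R] K, ∀ k, ρ (i k) = k := by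
  obtain ⟨s, hs⟩ := Module.projective_lifting_property (p.restrictScalars R)
    (LinearMap.id : C →ₗ[R] C) hp
  have hsplit :=
    (hex.split_tfae' (f := i.restrictScalars R) (g := p.restrictScalars R)).out 0 1
  obtain ⟨-, ρ, hρ⟩ := hsplit.1 ⟨hi, s, hs⟩
  exact ⟨ρ, LinearMap.congr_fun hρ⟩

/-- An extension of `R`-projective modules is `R`-projective. -/
theorem projective_of_exact {K E C : Type} [AddCommGroup K] [Module A K] [Module R K]
    [IsScalarTower R A K] [AddCommGroup E] [Module A E] [Module R E] [IsScalarTower R A E]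
    [AddCommGroup C] [Module A C] [Module R C] [IsScalarTower R A C]
    [Module.Projective R K] [Module.Projective R C] {i : K →ₗ[A] E} {p : E →ₗ[A] C}
    (hi : Injective i) (hp : Surjective p) (hex : Exact i p) : Module.Projective R E := by
  obtain ⟨ρ, hρ⟩ := exists_retraction_of_projective (R := R) hi hp hex
  have hsplit :=
    (hex.split_tfae' (f := i.restrictScalars R) (g := p.restrictScalars R)).out 1 2
  obtain ⟨e, -⟩ := hsplit.1 ⟨hp, ρ, LinearMap.ext hρ⟩
  exact Module.Projective.of_equiv e.symm

variable (R A) in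
/-- Finitely generated projective `(A, R)`-injective modules. -/
def IsProjInj (I : Type) [AddCommGroup I] [Module A I] : Prop :=
  Module.Finite A I ∧ Module.Projective A I ∧ IsRelInjective R A I

theorem IsProjInj.prod {I J : Type} [AddCommGroup I] [Module A I] [AddCommGroup J] [Module A J]
    (hI : IsProjInj R A I) (hJ : IsProjInj R A J) : IsProjInj R A (I × J) := by
  obtain ⟨_, _, hI⟩ := hI
  obtain ⟨_, _, hJ⟩ := hJ
  exact ⟨inferInstance, inferInstance, hI.prod hJ⟩

variable (R A) in
/-- Recursive form of `RelDomDimGE` for `R`-projective modules: the successive cokernels of the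
coresolution are required to be `R`-projective. -/
inductive HasRelDomDim : ℕ → (M : Type) → [AddCommGroup M] → [Module A M] → [Module R M] →
    [IsScalarTower R A M] → Prop
  | zero (M : Type) [AddCommGroup M] [Module A M] [Module R M] [IsScalarTower R A M]
      (hM : Module.Projective R M) : HasRelDomDim 0 M
  | succ {t : ℕ} {M I C : Type} [AddCommGroup M] [Module A M] [Module R M] [IsScalarTower R A M]
      [AddCommGroup I] [Module A I] [Module R I] [IsScalarTower R A I]
      [AddCommGroup C] [Module A C] [Module R C] [IsScalarTower R A C]
      (hM : Module.Projective R M) (hI : IsProjInj R A I) (f : M →ₗ[A] I) (p : I →ₗ[A] C)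
      (hf : Injective f) (hp : Surjective p) (hex : Exact f p) (hC : HasRelDomDim t C) :
      HasRelDomDim (t + 1) M

namespace HasRelDomDim

variable {M : Type} [AddCommGroup M] [Module A M] [Module R M] [IsScalarTower R A M]
  {N : Type} [AddCommGroup N] [Module A N] [Module R N] [IsScalarTower R A N]
  {E : Type} [AddCommGroup E] [Module A E] [Module R E] [IsScalarTower R A E]

theorem projective {t : ℕ} (h : HasRelDomDim R A t M) : Module.Projective R M := by
  cases h <;> assumption

theorem pred {t : ℕ} (h : HasRelDomDim R A (t + 1) M) : HasRelDomDim R A t M := by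
  induction t generalizing M with
  | zero => exact .zero M h.projective
  | succ t ih =>
    cases h with
    | succ hM hI f p hf hp hex hC => exact .succ hM hI f p hf hp hex (ih hC)

theorem mono {s t : ℕ} (hst : s ≤ t) (h : HasRelDomDim R A t M) : HasRelDomDim R A s M := by
  induction t, hst using Nat.le_induction with
  | base => exact h
  | succ t _ ih => exact ih h.pred

theorem of_subsingleton [Subsingleton M] (t : ℕ) : HasRelDomDim R A t M := by
  induction t with
  | zero => exact .zero M inferInstance
  | succ t ih =>
    exact .succ inferInstance
      ⟨inferInstance, inferInstance, IsRelInjective.of_subsingleton M⟩ LinearMap.id 0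
      (injective_id) (fun x => ⟨0, Subsingleton.elim _ _⟩)
      (fun x => ⟨fun _ => ⟨x, rfl⟩, fun _ => rfl⟩) ih

/-- The horseshoe lemma. -/
theorem extension {t : ℕ} (hM : HasRelDomDim R A t M) (hN : HasRelDomDim R A t N)
    (i : M →ₗ[A] E) (p : E →ₗ[A] N) (hi : Injective i) (hp : Surjective p) (hex : Exact i p) :
    HasRelDomDim R A t E := by
  have := hM.projective
  have := hN.projective
  have hE : Module.Projective R E := projective_of_exact hi hp hex
  induction t generalizing M N E with
  | zero => exact .zero E hE
  | succ t ih =>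
    obtain ⟨ρ, hρ⟩ := exists_retraction_of_projective (R := R) hi hp hex
    cases hM with
    | @succ _ _ I C _ _ _ _ _ _ _ _ _ _ _ _ _ hI f q hf hq hfq hC =>
    cases hN with
    | @succ _ _ J D _ _ _ _ _ _ _ _ _ _ _ _ _ hJ g r hg hr hgr hD =>
    obtain ⟨φ, hφ⟩ := hI.2.2.exists_extend i ρ hρ f
    let F : E →ₗ[A] I × J := φ.prod (g.comp p)
    have hF : Injective F := by
      rw [injective_iff_map_eq_zero]
      intro e he
      have h1 : φ e = 0 := congrArg Prod.fst he
      have h2 : g (p e) = 0 := congrArg Prod.snd he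
      obtain ⟨m, rfl⟩ := (hex e).1 ((injective_iff_map_eq_zero g).1 hg _ h2)
      rw [hφ] at h1
      rw [(injective_iff_map_eq_zero f).1 hf _ h1, map_zero]
    let L := LinearMap.range F
    have hpF : L ≤ LinearMap.ker (r.comp (LinearMap.snd A I J)) := by
      rintro _ ⟨e, rfl⟩
      exact (hgr _).2 ⟨p e, rfl⟩
    let b : ((I × J) ⧸ L) →ₗ[A] D := L.liftQ _ hpF
    have hb : Surjective b := fun d => by
      obtain ⟨y, rfl⟩ := hr d
      exact ⟨L.mkQ (0, y), rfl⟩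
    have hqa : LinearMap.range f ≤ LinearMap.ker (L.mkQ.comp (LinearMap.inl A I J)) := by
      rintro _ ⟨m, rfl⟩
      refine (Submodule.Quotient.mk_eq_zero L).2 ⟨i m, ?_⟩
      simp [F, hφ, (hex (i m)).2 ⟨m, rfl⟩]
    have hker : LinearMap.ker q = LinearMap.range f := hfq.linearMap_ker_eq
    obtain ⟨a, ha⟩ : ∃ a : C →ₗ[A] ((I × J) ⧸ L), ∀ x, a (q x) = L.mkQ (x, 0) :=
      exists_factor_of_ker_le hq _ (hker.trans_le hqa)
    have hainj : Injective a := by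
      rw [injective_iff_map_eq_zero]
      intro c hc
      obtain ⟨x, rfl⟩ := hq c
      rw [ha] at hc
      obtain ⟨e, he⟩ := (Submodule.Quotient.mk_eq_zero L).1 hc
      have h1 : φ e = x := congrArg Prod.fst he
      have h2 : g (p e) = 0 := congrArg Prod.snd he
      obtain ⟨m, rfl⟩ := (hex e).1 ((injective_iff_map_eq_zero g).1 hg _ h2)
      exact (hfq x).2 ⟨m, by rw [← hφ, h1]⟩
    have hab : Exact a b := by
      intro z
      constructor
      · intro hz
        obtain ⟨⟨x, y⟩, rfl⟩ := L.mkQ_surjective z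
        obtain ⟨n, hn⟩ := (hgr y).1 hz
        obtain ⟨e, rfl⟩ := hp n
        refine ⟨q (x - φ e), ?_⟩
        rw [ha, ← sub_eq_zero, ← map_sub]
        refine (Submodule.Quotient.mk_eq_zero L).2 ⟨-e, ?_⟩
        simp [F, hn]
      · rintro ⟨c, rfl⟩
        obtain ⟨x, rfl⟩ := hq c
        rw [ha]
        exact map_zero r
    have hCproj := hC.projective
    have hDproj := hD.projective
    exact .succ hE (hI.prod hJ) F L.mkQ hF L.mkQ_surjective
      (LinearMap.exact_iff.2 (by simp [L]))
      (ih hC hD a b hainj hb hab hCproj hDproj (projective_of_exact hainj hb hab))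

theorem of_isSummandOf {t : ℕ} (hE : HasRelDomDim R A t E) (h : IsSummandOf A M E) :
    HasRelDomDim R A t M := by
  obtain ⟨i, r, hri⟩ := h
  replace hri : ∀ m, r (i m) = m := LinearMap.congr_fun hri
  have := hE.projective
  have hM : Module.Projective R M := Module.Projective.of_split (i.restrictScalars R)
    (r.restrictScalars R) (LinearMap.ext hri)
  induction t generalizing M E with
  | zero => exact .zero M hM
  | succ t ih =>
    have hEt := hE.pred
    cases hE with
    | @succ _ _ I C _ _ _ _ _ _ _ _ _ _ _ _ _ hI f q hf hq hfq hC =>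
    let N := LinearMap.ker r
    let pr : E →ₗ[A] N := (LinearMap.id - i.comp r).codRestrict N fun e => by simp [N, hri]
    have hpr : ∀ n : N, pr n = n := fun n => Subtype.ext <| by
      have : r n = 0 := n.2
      simp [pr, this]
    have hN : HasRelDomDim R A t N := ih hEt N.subtype pr hpr ‹_›
      (Module.Projective.of_split (N.subtype.restrictScalars R) (pr.restrictScalars R)
        (LinearMap.ext hpr))
    let L := LinearMap.range (f.comp i)
    have hL : L ≤ LinearMap.ker q := by
      rintro _ ⟨m, rfl⟩
      exact (hfq _).2 ⟨i m, rfl⟩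
    let a : N →ₗ[A] I ⧸ L := L.mkQ.comp (f.comp N.subtype)
    let b : (I ⧸ L) →ₗ[A] C := L.liftQ q hL
    have ha : Injective a := by
      rw [injective_iff_map_eq_zero]
      rintro ⟨n, hn⟩ h0
      obtain ⟨m, hm⟩ := (Submodule.Quotient.mk_eq_zero L).1 h0
      have hm : i m = n := hf hm
      have hn : r n = 0 := hn
      have hm0 : m = 0 := by rw [← hri m, hm, hn]
      exact Subtype.ext (by simp [← hm, hm0])
    have hb : Surjective b := fun c => by
      obtain ⟨x, rfl⟩ := hq c
      exact ⟨L.mkQ x, rfl⟩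
    have hab : Exact a b := by
      intro z
      constructor
      · intro hz
        obtain ⟨x, rfl⟩ := L.mkQ_surjective z
        obtain ⟨e, rfl⟩ := (hfq x).1 hz
        refine ⟨pr e, ?_⟩
        rw [← sub_eq_zero]
        change L.mkQ (f (pr e)) - L.mkQ (f e) = 0
        rw [← map_sub]
        exact (Submodule.Quotient.mk_eq_zero L).2 ⟨-r e, by simp [pr]⟩
      · rintro ⟨n, rfl⟩
        exact (hfq _).2 ⟨n, rfl⟩
    refine .succ hM hI (f.comp i) L.mkQ ?_ L.mkQ_surjective (LinearMap.exact_iff.2 (by simp [L]))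
      (hN.extension hC a b ha hb hab)
    exact hf.comp (LeftInverse.injective hri)

theorem pi_fin {t : ℕ} (hM : HasRelDomDim R A t M) (n : ℕ) :
    HasRelDomDim R A t (Fin n → M) := by
  induction n with
  | zero => exact of_subsingleton t
  | succ n ih =>
    refine hM.extension ih (LinearMap.single A (fun _ : Fin (n + 1) => M) 0)
      (LinearMap.funLeft A M Fin.succ) (Pi.single_injective (M := fun _ : Fin (n + 1) => M) 0) ?_ ?_
    · exact fun g => ⟨Fin.cons 0 g, rfl⟩
    · intro g
      constructor
      · intro hg
        refine ⟨g 0, funext fun j => ?_⟩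
        refine Fin.cases (by simp) (fun k => ?_) j
        have : g k.succ = 0 := congrFun hg k
        simp [this]
      · rintro ⟨m, rfl⟩
        ext k
        simp [LinearMap.funLeft]

/-- The dominant dimension drops by at most one on cokernels. -/
theorem of_exact {t : ℕ} (hK : HasRelDomDim R A (t + 1) N) (hE : HasRelDomDim R A t E)
    [Module.Projective R M] (i : N →ₗ[A] E) (p : E →ₗ[A] M) (hi : Injective i)
    (hp : Surjective p) (hex : Exact i p) : HasRelDomDim R A t M := by
  obtain ⟨ρ, hρ⟩ := exists_retraction_of_projective (R := R) hi hp hex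
  cases hK with
  | @succ _ _ I C _ _ _ _ _ _ _ _ _ _ _ _ _ hI f q hf hq hfq hC =>
  obtain ⟨φ, hφ⟩ := hI.2.2.exists_extend i ρ hρ f
  have hker : LinearMap.ker p ≤ LinearMap.ker (q.comp φ) := by
    intro e he
    obtain ⟨k, rfl⟩ := (hex e).1 he
    exact (hfq _).2 ⟨k, (hφ k).symm⟩
  obtain ⟨ψ, hψ⟩ : ∃ ψ : M →ₗ[A] C, ∀ e, ψ (p e) = q (φ e) :=
    exists_factor_of_ker_le hp _ hker
  have key : HasRelDomDim R A t (I × M) := by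
    refine hE.extension hC (φ.prod p) (q.coprod (-ψ)) ?_ ?_ ?_
    · rw [injective_iff_map_eq_zero]
      intro e he
      have h1 : φ e = 0 := congrArg Prod.fst he
      obtain ⟨k, rfl⟩ := (hex e).1 (congrArg Prod.snd he)
      rw [hφ] at h1
      rw [(injective_iff_map_eq_zero f).1 hf _ h1, map_zero]
    · intro c
      obtain ⟨x, rfl⟩ := hq c
      exact ⟨(x, 0), by simp⟩
    · rintro ⟨x, m⟩
      constructor
      · intro h
        obtain ⟨e, rfl⟩ := hp m
        have h' : q (x - φ e) = 0 := by simpa [hψ, sub_eq_add_neg] using h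
        obtain ⟨k, hk⟩ := (hfq _).1 h'
        exact ⟨e + i k, by simp [hφ, hk, (hex (i k)).2 ⟨k, rfl⟩]⟩
      · rintro ⟨e, he⟩
        rw [← he]
        simp [hψ]
  exact key.of_isSummandOf ⟨LinearMap.inr A I M, LinearMap.snd A I M, LinearMap.snd_comp_inr A I M⟩

theorem of_finite_projective {t : ℕ} (hA : HasRelDomDim R A t A) [Module.Finite A M]
    [Module.Projective A M] : HasRelDomDim R A t M := by
  obtain ⟨n, g, hg⟩ := Module.Finite.exists_fin' A M
  obtain ⟨s, hs⟩ := Module.projective_lifting_property g LinearMap.id hg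
  exact (hA.pi_fin n).of_isSummandOf ⟨s, g, hs⟩

theorem of_hasFilt {t : ℕ} {Θ : ModPred A} {C : Type} [AddCommGroup C] [Module A C]
    (hC : HasFilt A Θ C)
    (hΘ : ∀ (T : Type) [AddCommGroup T] [Module A T] [Module R T] [IsScalarTower R A T],
      Θ T → HasRelDomDim R A t T) [Module R C] [IsScalarTower R A C] :
    HasRelDomDim R A t C := by
  rename_i instR instTower
  revert instR instTower
  induction hC with
  | of_subsingleton M hM => intro _ _; exact of_subsingleton t
  | step K M Q i p hi hp hex hQ hK ih =>
    intro _ _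
    let _ := Module.compHom K (algebraMap R A)
    let _ := Module.compHom Q (algebraMap R A)
    have : IsScalarTower R A K := .of_algebraMap_smul fun _ _ => rfl
    have : IsScalarTower R A Q := .of_algebraMap_smul fun _ _ => rfl
    exact ih.extension (hΘ Q hQ) i p hi hp hex

end HasRelDomDim

end RelativeInjectives

section Coresolutions

variable {R : Type} [CommRing R] {A : Type} [Ring A] [Algebra R A]
  {M : Type} [AddCommGroup M] [Module A M] [Module R M] [IsScalarTower R A M]

theorem RelDomDimGE.zero (M : Type) [AddCommGroup M] [Module A M] [Module R M]
    [IsScalarTower R A M] : RelDomDimGE R A 0 M :=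
  ⟨{ X := fun _ => PUnit
     projinj := by omega
     f := 0
     d := fun _ => 0
     hf := by omega
     hfsplit := by omega
     hexact0 := by omega
     hexact := by omega
     hdsplit := by omega }⟩

theorem RelDomDimGE.cons {t : ℕ} {I C : Type}
    [AddCommGroup I] [Module A I] [Module R I] [IsScalarTower R A I]
    [AddCommGroup C] [Module A C] [Module R C] [IsScalarTower R A C] [Module.Projective R C]
    (hI : IsProjInj R A I) (f : M →ₗ[A] I) (p : I →ₗ[A] C)
    (hf : Injective f) (hp : Surjective p) (hex : Exact f p) (hC : RelDomDimGE R A t C) :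
    RelDomDimGE R A (t + 1) M := by
  obtain ⟨c⟩ := hC
  obtain ⟨ρ, hρ⟩ := exists_retraction_of_projective (R := R) hf hp hex
  obtain ⟨s, hs⟩ := Module.projective_lifting_property (p.restrictScalars R)
    (LinearMap.id : C →ₗ[R] C) hp
  replace hs : ∀ x, p (s x) = x := LinearMap.congr_fun hs
  let X : ℕ → Type := fun n => Nat.casesOn n I c.X
  let grp : ∀ n, AddCommGroup (X n) := fun n => match n with | 0 => ‹_› | n + 1 => c.grp n
  let modA : ∀ n, @Module A (X n) _ (grp n).toAddCommMonoid := fun n =>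
    match n with | 0 => ‹_› | n + 1 => c.modA n
  let modR : ∀ n, @Module R (X n) _ (grp n).toAddCommMonoid := fun n =>
    match n with | 0 => ‹_› | n + 1 => c.modR n
  refine ⟨{ X := X
            grp := grp
            modA := modA
            modR := modR
            tower := fun n => match n with
              | 0 => ‹_›
              | n + 1 => c.tower n
            projinj := fun n hn => match n with
              | 0 => hI
              | n + 1 => c.projinj n (by omega)
            f := f
            d := fun n => match n with | 0 => (c.f.comp p : I →ₗ[A] c.X 0) | n + 1 => c.d n
            hf := fun _ => hf
            hfsplit := fun _ => ⟨ρ, fun x => congrArg f (hρ x)⟩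
            hexact0 := fun h x => ?_
            hexact := fun n hn => match n with | 0 => fun y => ?_ | n + 1 => c.hexact n (by omega)
            hdsplit := fun n hn => match n with | 0 => ?_ | n + 1 => c.hdsplit n (by omega) }⟩
  · rw [← hex x]
    change c.f (p x) = 0 ↔ _
    exact map_eq_zero_iff _ (c.hf (by omega))
  · refine (c.hexact0 (by omega) y).trans ?_
    constructor
    · rintro ⟨z, rfl⟩
      obtain ⟨x, rfl⟩ := hp z
      exact ⟨x, rfl⟩
    · rintro ⟨x, rfl⟩
      exact ⟨p x, rfl⟩
  · obtain ⟨h, hh⟩ := c.hfsplit (by omega)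
    refine ⟨s.comp h, fun x => ?_⟩
    change c.f (p (s (h (c.f (p x))))) = c.f (p x)
    rw [hs, hh]

theorem HasRelDomDim.relDomDimGE {t : ℕ} (h : HasRelDomDim R A t M) : RelDomDimGE R A t M := by
  induction t generalizing M with
  | zero => exact .zero M
  | succ t ih =>
    cases h with
    | succ hM hI f p hf hp hex hC =>
      have := hC.projective
      exact .cons hI f p hf hp hex (ih hC)

theorem projective_of_tower [Module.Projective R A] [Module.Projective A M] :
    Module.Projective R M := by
  classical
  obtain ⟨s, hs⟩ := Module.projective_def'.1 ‹Module.Projective A M›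
  have : Module.Projective R (M →₀ A) := .of_equiv (finsuppLequivDFinsupp R).symm
  exact Module.Projective.of_split (s.restrictScalars R)
    ((Finsupp.linearCombination A id).restrictScalars R)
    (LinearMap.ext fun x => LinearMap.congr_fun hs x)

theorem RelDomDimGE.hasRelDomDim [Module.Projective R A] {t : ℕ} (hM : Module.Projective R M)
    (h : RelDomDimGE R A t M) : HasRelDomDim R A t M := by
  induction t generalizing M with
  | zero => exact .zero M hM
  | succ t ih =>
    obtain ⟨c⟩ := h
    have hI := c.projinj 0 (by omega)
    have := hI.2.1
    have hX : Module.Projective R (c.X 0) := projective_of_tower (A := A)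
    have hf := c.hf (by omega)
    obtain ⟨ρ, hρ⟩ := c.hfsplit (by omega)
    let L := LinearMap.range c.f
    have hC : Module.Projective R (c.X 0 ⧸ L) := by
      let u : c.X 0 →ₗ[R] c.X 0 := LinearMap.id - (c.f.restrictScalars R).comp ρ
      have hu : ∀ x ∈ L, u x = 0 := by
        rintro _ ⟨m, rfl⟩
        simp [u, hρ]
      let v : (c.X 0 ⧸ L) →ₗ[R] c.X 0 :=
        ((L.restrictScalars R).liftQ u hu).comp
          (Submodule.Quotient.restrictScalarsEquiv R L).symm.toLinearMap
      refine Module.Projective.of_split v (L.mkQ.restrictScalars R) (LinearMap.ext fun z => ?_)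
      obtain ⟨x, rfl⟩ := L.mkQ_surjective z
      change L.mkQ (x - c.f (ρ x)) = L.mkQ x
      rw [← sub_eq_zero, ← map_sub]
      exact (Submodule.Quotient.mk_eq_zero L).2 ⟨-ρ x, by simp⟩
    refine .succ hM hI c.f L.mkQ hf L.mkQ_surjective (LinearMap.exact_iff.2 (by simp [L]))
      (ih hC ?_)
    cases t with
    | zero => exact .zero _
    | succ t =>
      have hex := c.hexact0 (by omega)
      have hL : L ≤ LinearMap.ker (c.d 0) := hex.linearMap_ker_eq.ge
      refine ⟨{ X := fun n => c.X (n + 1)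
                projinj := fun n hn => c.projinj (n + 1) (by omega)
                f := L.liftQ (c.d 0) hL
                d := fun n => c.d (n + 1)
                hf := fun _ => LinearMap.ker_eq_bot.1
                  (Submodule.ker_liftQ_eq_bot _ _ _ hex.linearMap_ker_eq.le)
                hfsplit := fun _ => ?_
                hexact0 := fun h y => ?_
                hexact := fun n hn => c.hexact (n + 1) (by omega)
                hdsplit := fun n hn => c.hdsplit (n + 1) (by omega) }⟩
      · obtain ⟨h, hh⟩ := c.hdsplit 0 (by omega)
        refine ⟨(L.mkQ.restrictScalars R).comp h, fun z => ?_⟩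
        obtain ⟨x, rfl⟩ := L.mkQ_surjective z
        exact hh x
      · refine (c.hexact 0 (by omega) y).trans ⟨?_, ?_⟩
        · rintro ⟨x, rfl⟩
          exact ⟨L.mkQ x, rfl⟩
        · rintro ⟨z, rfl⟩
          obtain ⟨x, rfl⟩ := L.mkQ_surjective z
          exact ⟨x, rfl⟩

end Coresolutions

namespace SplitQH

variable {R : Type} [CommRing R] {A : Type} [Ring A] [Algebra R A]

theorem hasRelDomDim_standard (Q : SplitQH R A) (dl : Q.Λ → ℕ)
    (hdl : ∀ l m : Q.Λ, l < m → dl m < dl l) {t : ℕ} (hA : HasRelDomDim R A t A) (l : Q.Λ) :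
    HasRelDomDim R A (t - dl l) (Q.Δ l) := by
  induction hd : dl l using Nat.strong_induction_on generalizing l with
  | _ d ih =>
    subst hd
    have := (Q.rproj l).2
    have := Q.pfin l
    have := Q.pproj l
    rcases Nat.eq_zero_or_pos (t - dl l) with h0 | hpos
    · rw [h0]
      exact .zero _ (Q.rproj l).2
    obtain ⟨C, ι, hι, hex, hfilt⟩ := Q.kernel_filtered l
    let _ := Module.compHom C (algebraMap R A)
    let _ := Module.compHom (Q.Pr l) (algebraMap R A)
    have : IsScalarTower R A C := .of_algebraMap_smul fun _ _ => rfl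
    have : IsScalarTower R A (Q.Pr l) := .of_algebraMap_smul fun _ _ => rfl
    have hC : HasRelDomDim R A (t - dl l + 1) C := by
      refine .of_hasFilt hfilt fun T _ _ _ _ ⟨m, hlm, n, hT⟩ => ?_
      have hlt := hdl l m hlm
      exact (((ih (dl m) hlt m rfl).mono (by omega)).pi_fin n).of_isSummandOf hT
    exact hC.of_exact (hA.of_finite_projective.mono (Nat.sub_le _ _)) ι (Q.π l) hι (Q.hπ l) hex

end SplitQH

/-- Let `(A, {Δ(λ)})` be a split quasi-hereditary algebra over a
commutative Noetherian ring `R`, and `(A, P, V)` an RQF3 algebra (`P` a projective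
`(A,R)`-injective strongly faithful left module, `V` such a right module).  Then for every
`λ ∈ Λ`, `domdim_{(A,R)} Δ(λ) ≥ domdim(A, R) − d(Λ, λ)`, where `d(Λ, λ)` is the length of
the longest chain in `Λ` starting at `λ`.  (Formulated for each `t`: if
`domdim(A,R) ≥ t` then `domdim_{(A,R)} Δ(λ) ≥ t − d(Λ, λ)`.) -/
theorem relDomDim_standard_ge
    (R : Type) [CommRing R] [IsNoetherianRing R]
    (A : Type) [Ring A] [Algebra R A] [Module.Finite R A] [Module.Projective R A]
    (Q : SplitQH R A)
    (P : Type) [AddCommGroup P] [Module A P] [Module R P] [IsScalarTower R A P]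
    (hP : Module.Finite A P ∧ Module.Projective A P ∧ IsRelInjective R A P ∧
      IsRelStronglyFaithful R A P)
    (V : Type) [AddCommGroup V] [Module Aᵐᵒᵖ V] [Module R V] [IsScalarTower R Aᵐᵒᵖ V]
    (hV : Module.Finite Aᵐᵒᵖ V ∧ Module.Projective Aᵐᵒᵖ V ∧ IsRelInjective R Aᵐᵒᵖ V ∧
      IsRelStronglyFaithful R Aᵐᵒᵖ V)
    (dl : Q.Λ → ℕ)
    (hdl : ∀ l : Q.Λ,
      (∃ c : Fin (dl l + 1) → Q.Λ, StrictMono c ∧ c 0 = l) ∧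
      (∀ (t : ℕ) (c : Fin (t + 1) → Q.Λ), StrictMono c → c 0 = l → t ≤ dl l))
    (l : Q.Λ) (t : ℕ)
    (hdom : RelDomDimGE R A t A) :
    RelDomDimGE R A (t - dl l) (Q.Δ l) := by
  have hlt : ∀ l m : Q.Λ, l < m → dl m < dl l := by
    intro l m hlm
    obtain ⟨c, hc, hc0⟩ := (hdl m).1
    refine (hdl l).2 (dl m + 1) (Fin.cons l c)
      (Fin.strictMono_iff_lt_succ.2 fun i => ?_) rfl
    cases i using Fin.cases with
    | zero => simpa [hc0] using hlm
    | succ i => simpa [← Fin.succ_castSucc] using hc i.castSucc_lt_succ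
  exact (Q.hasRelDomDim_standard dl hlt (hdom.hasRelDomDim ‹_›) l).relDomDimGE
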